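/- arXiv:1711.02663 — 9 statements merged into one kernel-verified Lean document; each statement's English description precedes it below -/
import Mathlib

section
/- The intersection of all simple density ideals equals the ideal of finite sets: ⋂_{g ∈ G} Z_g = Fin, i.e., a set A ⊆ ω belongs to Z_g for every g ∈ G if and only if A is finite. -/
open Filter

/-- `cnt A n` is the cardinality of `A ∩ {0, …, n-1}`. -/
noncomputable def cnt (A : Set ℕ) (n : ℕ) : ℕ := (A ∩ Set.Iio n).ncard

/-- `G` : functions `g : ω → (0,∞)` with `g n → ∞` and `n / g n` not tending to `0`. -/
def inG (g : ℕ → ℝ) : Prop :=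
  (∀ n, 0 < g n) ∧ Tendsto g atTop atTop ∧
    ¬ Tendsto (fun n : ℕ => (n : ℝ) / g n) atTop (nhds 0)

/-- The simple density ideal `Z_g`. -/
def Zg (g : ℕ → ℝ) : Set (Set ℕ) :=
  {A | Tendsto (fun n => (cnt A n : ℝ) / g n) atTop (nhds 0)}

/-- `Z_g` for an `ω`-valued function. -/
def ZgN (g : ℕ → ℕ) : Set (Set ℕ) := Zg (fun n => (g n : ℝ))

/-- `H↑` : nondecreasing members of `G` with values in `ω`. -/
def inHup (f : ℕ → ℕ) : Prop := inG (fun n => (f n : ℝ)) ∧ Monotone f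

theorem cnt_mono (A : Set ℕ) : Monotone (cnt A) := fun _ _ h =>
  Set.ncard_le_ncard (Set.inter_subset_inter_right _ (Set.Iio_subset_Iio h))
    ((Set.finite_Iio _).inter_of_right _)

theorem cnt_le (A : Set ℕ) (n : ℕ) : cnt A n ≤ n := by
  have h := Set.ncard_le_ncard (Set.inter_subset_right (s := A) (t := Set.Iio n))
    (Set.finite_Iio n)
  rwa [← Finset.coe_Iio, Set.ncard_coe_finset, Nat.card_Iio, Finset.coe_Iio] at h

theorem Set.Infinite.tendsto_cnt_atTop {A : Set ℕ} (hA : A.Infinite) :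
    Tendsto (cnt A) atTop atTop := by
  refine tendsto_atTop_atTop_of_monotone (cnt_mono A) fun k => ?_
  obtain ⟨t, htA, rfl⟩ := hA.exists_subset_card_eq k
  obtain ⟨b, hb⟩ := t.bddAbove
  refine ⟨b + 1, ?_⟩
  rw [← Set.ncard_coe_finset]
  exact Set.ncard_le_ncard (fun x hx => ⟨htA hx, Nat.lt_succ_of_le (hb hx)⟩)
    ((Set.finite_Iio _).inter_of_right _)

theorem not_tendsto_div_add_one_zero {u c : ℕ → ℕ} (hc : Tendsto c atTop atTop)
    (hcu : ∀ n, c n ≤ u n) :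
    ¬ Tendsto (fun n => (u n : ℝ) / ((c n : ℝ) + 1)) atTop (nhds 0) := by
  intro h
  obtain ⟨n, hn, hn'⟩ := ((h.eventually_lt_const (show (0 : ℝ) < 1 / 2 by norm_num)).and
    (hc.eventually_ge_atTop 1)).exists
  rw [div_lt_iff₀ (by positivity)] at hn
  have h₁ : (c n : ℝ) ≤ u n := by exact_mod_cast hcu n
  have h₂ : (1 : ℝ) ≤ c n := by exact_mod_cast hn'
  linarith

/-- The intersection of all simple density ideals equals `Fin`. -/
theorem inter_simple_density_eq_fin (A : Set ℕ) :
    (∀ g : ℕ → ℝ, inG g → A ∈ Zg g) ↔ A.Finite := by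
  constructor
  · intro h
    by_contra hA
    have hc := Set.Infinite.tendsto_cnt_atTop hA
    refine not_tendsto_div_add_one_zero hc (fun _ => le_rfl)
      (h (fun n => (cnt A n : ℝ) + 1) ⟨fun n => by positivity, ?_, ?_⟩)
    · exact tendsto_atTop_add_const_right _ _ (tendsto_natCast_atTop_atTop.comp hc)
    · exact not_tendsto_div_add_one_zero (u := fun n => n) hc (cnt_le A)
  · rintro hA g ⟨hpos, hg, -⟩
    refine squeeze_zero (fun n => div_nonneg (Nat.cast_nonneg _) (hpos n).le) (fun n => ?_)
      (hg.const_div_atTop (A.ncard : ℝ))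
    refine div_le_div_of_nonneg_right ?_ (hpos n).le
    exact_mod_cast Set.ncard_le_ncard Set.inter_subset_left hA
end

section
/- The union of all simple density ideals equals the family of sets of lower asymptotic density zero: ⋃_{g ∈ G} Z_g = Z_l, i.e., a set A ⊆ ω belongs to Z_g for some g ∈ G if and only if liminf_{n→∞} |A ∩ {0,…,n−1}|/n = 0. -/
open Filter

theorem cnt_div_le_one (A : Set ℕ) (n : ℕ) : (cnt A n : ℝ) / n ≤ 1 :=
  div_le_one_of_le₀ (by exact_mod_cast cnt_le A n) n.cast_nonneg

/-- The lower density vanishes iff the relative counts are infinitely often arbitrarily small. -/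
theorem liminf_cnt_div_eq_zero_iff (A : Set ℕ) :
    liminf (fun n : ℕ => (cnt A n : ℝ) / (n : ℝ)) atTop = 0 ↔
      ∀ ε : ℝ, 0 < ε → ∃ᶠ n : ℕ in atTop, (cnt A n : ℝ) / n < ε := by
  have hb : IsBoundedUnder (· ≥ ·) atTop (fun n : ℕ => (cnt A n : ℝ) / (n : ℝ)) :=
    isBoundedUnder_of ⟨0, fun n => by positivity⟩
  have hc : IsCoboundedUnder (· ≥ ·) atTop (fun n : ℕ => (cnt A n : ℝ) / (n : ℝ)) :=
    (isBoundedUnder_of ⟨1, cnt_div_le_one A⟩ :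
      IsBoundedUnder (· ≤ ·) atTop _).isCoboundedUnder_ge
  constructor
  · intro h ε hε
    exact frequently_lt_of_liminf_lt hc (h ▸ hε)
  · intro h
    refine le_antisymm (le_of_forall_pos_le_add fun ε hε => ?_) ?_
    · rw [zero_add]
      exact liminf_le_of_frequently_le ((h ε hε).mono fun _ hn => hn.le) hb
    · exact le_liminf_of_le hc (Eventually.of_forall fun n => by positivity)

theorem frequently_cnt_div_lt_of_mem_Zg {A : Set ℕ} {g : ℕ → ℝ} (hg : inG g) (hA : A ∈ Zg g)
    {ε : ℝ} (hε : 0 < ε) : ∃ᶠ n : ℕ in atTop, (cnt A n : ℝ) / n < ε := by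
  obtain ⟨hpos, -, hnot⟩ := hg
  have hA : Tendsto (fun n => (cnt A n : ℝ) / g n) atTop (nhds 0) := hA
  intro hev
  refine hnot (squeeze_zero' (Eventually.of_forall fun n => ?_) ?_
    (by simpa using hA.const_mul ε⁻¹))
  · exact div_nonneg n.cast_nonneg (hpos n).le
  · filter_upwards [hev, eventually_gt_atTop 0] with n hn hn0
    have hn0' : (0 : ℝ) < n := by exact_mod_cast hn0
    rw [not_lt, le_div_iff₀ hn0'] at hn
    rw [← mul_div_assoc]
    refine div_le_div_of_nonneg_right ?_ (hpos n).le
    rwa [le_inv_mul_iff₀ hε]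

theorem exists_mem_Zg_of_frequently_cnt_div_lt {A : Set ℕ}
    (h : ∀ ε : ℝ, 0 < ε → ∃ᶠ n : ℕ in atTop, (cnt A n : ℝ) / n < ε) :
    ∃ g : ℕ → ℝ, inG g ∧ A ∈ Zg g := by
  classical
  obtain ⟨φ, hφ, hlt⟩ := extraction_forall_of_frequently
    (fun k : ℕ => h (1 / ((k : ℝ) + 1)) (by positivity))
  let g : ℕ → ℝ := fun n => if n ∈ Set.range φ then (n : ℝ) + 1 else ((n : ℝ) + 1) ^ 2
  have hle : ∀ n : ℕ, (n : ℝ) + 1 ≤ g n := fun n => by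
    have := n.cast_nonneg (α := ℝ)
    dsimp only [g]
    split_ifs
    · exact le_rfl
    · nlinarith
  have hpos : ∀ n, 0 < g n := fun n => lt_of_lt_of_le (by positivity) (hle n)
  refine ⟨g, ⟨hpos, ?_, fun ht => ?_⟩, ?_⟩
  · exact tendsto_atTop_mono hle (tendsto_atTop_add_const_right _ _ tendsto_natCast_atTop_atTop)
  · have hφt := ht.comp hφ.tendsto_atTop
    obtain ⟨k, hk, hk0⟩ := ((hφt.eventually_lt_const (show (0 : ℝ) < 1 / 2 by norm_num)).and
      (eventually_gt_atTop 0)).exists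
    have h1 : (1 : ℝ) ≤ φ k := by exact_mod_cast hk0.trans_le (hφ.id_le k)
    simp only [Function.comp_apply, g, Set.mem_range_self, if_true] at hk
    rw [div_lt_iff₀ (by positivity)] at hk
    linarith
  · change Tendsto (fun n => (cnt A n : ℝ) / g n) atTop (nhds 0)
    rw [Metric.tendsto_atTop]
    intro ε hε
    obtain ⟨K, hK⟩ := exists_nat_one_div_lt hε
    refine ⟨φ K, fun n hn => ?_⟩
    have hKn : K ≤ n := (hφ.id_le K).trans hn
    rw [Real.dist_0_eq_abs, abs_of_nonneg (div_nonneg (Nat.cast_nonneg _) (hpos n).le)]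
    refine lt_of_le_of_lt ?_ hK
    by_cases hr : n ∈ Set.range φ
    · obtain ⟨k, rfl⟩ := hr
      have hKk : K ≤ k := hφ.le_iff_le.mp hn
      obtain h0 | h0 := (φ k).eq_zero_or_pos
      · have hc : cnt A (φ k) = 0 := Nat.le_zero.mp (h0 ▸ cnt_le A (φ k))
        rw [hc, Nat.cast_zero, zero_div]
        positivity
      · calc (cnt A (φ k) : ℝ) / g (φ k) ≤ cnt A (φ k) / φ k :=
              div_le_div_of_nonneg_left (Nat.cast_nonneg _) (by exact_mod_cast h0)
                (by linarith [hle (φ k)])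
          _ ≤ 1 / ((k : ℝ) + 1) := (hlt k).le
          _ ≤ 1 / ((K : ℝ) + 1) := Nat.one_div_le_one_div hKk
    · refine le_trans ?_ (Nat.one_div_le_one_div hKn)
      have hc : (cnt A n : ℝ) ≤ n := by exact_mod_cast cnt_le A n
      simp only [g, hr, if_false]
      rw [div_le_div_iff₀ (by positivity) (by positivity)]
      nlinarith [n.cast_nonneg (α := ℝ)]

/-- The union of all simple density ideals equals the family of sets of
lower asymptotic density zero. -/
theorem union_simple_density_eq_lower_density_zero (A : Set ℕ) :
    (∃ g : ℕ → ℝ, inG g ∧ A ∈ Zg g) ↔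
      liminf (fun n : ℕ => (cnt A n : ℝ) / (n : ℝ)) atTop = 0 := by
  rw [liminf_cnt_div_eq_zero_iff]
  exact ⟨fun ⟨_, hg, hA⟩ _ hε => frequently_cnt_div_lt_of_mem_Zg hg hA hε,
    exists_mem_Zg_of_frequently_cnt_div_lt⟩
end

section
/- For any nondecreasing f ∈ G with values in ω and any infinite set A ⊆ ω with increasing enumeration A = {a_0 < a_1 < …}, one has A ∈ Z_f if and only if |A ∩ {0,…,a_k−1}|/f(a_k) → 0 as k → ∞. -/
open Filter

theorem cnt_range_apply {a : ℕ → ℕ} (ha : StrictMono a) (k : ℕ) :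
    cnt (Set.range a) (a k) = k := by
  have h : Set.range a ∩ Set.Iio (a k) = a '' Set.Iio k := by
    ext x
    constructor
    · rintro ⟨⟨j, rfl⟩, hj⟩
      exact ⟨j, ha.lt_iff_lt.mp hj, rfl⟩
    · rintro ⟨j, hj, rfl⟩
      exact ⟨⟨j, rfl⟩, ha hj⟩
  rw [cnt, h, Set.ncard_image_of_injective _ ha.injective, ← Finset.coe_Iio,
    Set.ncard_coe_finset, Nat.card_Iio]

theorem tendsto_cnt_range_atTop {a : ℕ → ℕ} (ha : StrictMono a) :
    Tendsto (cnt (Set.range a)) atTop atTop :=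
  tendsto_atTop_atTop_of_monotone (cnt_mono _) fun k => ⟨a k, (cnt_range_apply ha k).ge⟩

/-- For nondecreasing `f ∈ G` with values in `ω` and an infinite `A ⊆ ω` with increasing
enumeration `a`, membership `A ∈ Z_f` is equivalent to `|A ∩ a_k| / f(a_k) → 0`. -/
theorem mem_Zg_iff_along_enumeration (f : ℕ → ℕ) (hf : inHup f)
    (A : Set ℕ) (hA : A.Infinite) (a : ℕ → ℕ) (ha : StrictMono a)
    (hrange : Set.range a = A) :
    A ∈ ZgN f ↔ Tendsto (fun k => (cnt A (a k) : ℝ) / (f (a k) : ℝ)) atTop (nhds 0) := by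
  subst hrange
  obtain ⟨⟨hpos, htop, -⟩, hmono⟩ := hf
  refine ⟨fun h => h.comp ha.tendsto_atTop, fun h => ?_⟩
  simp only [cnt_range_apply ha] at h
  have hsum := (h.comp ((tendsto_sub_atTop_nat 1).comp (tendsto_cnt_range_atTop ha))).add
    (tendsto_inv_atTop_zero.comp htop)
  rw [add_zero] at hsum
  refine squeeze_zero (fun n => by positivity) (fun n => ?_) hsum
  simp only [Function.comp_apply]
  rcases hc : cnt (Set.range a) n with _ | c
  · simp
  have hlt : a c < n := by
    by_contra! hle
    have := cnt_mono (Set.range a) hle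
    rw [cnt_range_apply ha, hc] at this
    omega
  have hle : (f (a c) : ℝ) ≤ f n := by exact_mod_cast hmono hlt.le
  have hdiv : (c : ℝ) / f n ≤ c / f (a c) :=
    div_le_div_of_nonneg_left c.cast_nonneg (hpos (a c)) hle
  rw [Nat.add_sub_cancel, Nat.cast_succ, add_div, one_div]
  gcongr
end

section
/- Suppose f, g are nondecreasing functions in G with values in ω and Z_f = Z_g. Then Z_{max{f,g}} = Z_f, where max{f,g} is the pointwise maximum of f and g. -/
open Filter

theorem cnt_mono_s5 {A B : Set ℕ} (h : A ⊆ B) (n : ℕ) : cnt A n ≤ cnt B n :=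
  Set.ncard_le_ncard (Set.inter_subset_inter_left _ h) ((Set.finite_Iio n).inter_of_right _)

theorem cnt_union_le (A B : Set ℕ) (n : ℕ) : cnt (A ∪ B) n ≤ cnt A n + cnt B n := by
  unfold cnt
  rw [Set.union_inter_distrib_right]
  exact Set.ncard_union_le _ _

theorem cnt_succ_of_notMem {A : Set ℕ} {n : ℕ} (h : n ∉ A) : cnt A (n + 1) = cnt A n := by
  unfold cnt
  congr 1
  ext x
  simp only [Set.mem_inter_iff, Set.mem_Iio, and_congr_right_iff]
  intro hx
  have : x ≠ n := fun e => h (e ▸ hx)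
  omega

theorem mem_ZgN_iff {f : ℕ → ℕ} (hf : ∀ n, 0 < (f n : ℝ)) {A : Set ℕ} :
    A ∈ ZgN f ↔ ∀ ε : ℝ, 0 < ε → ∀ᶠ n in atTop, (cnt A n : ℝ) ≤ ε * f n := by
  have h : A ∈ ZgN f ↔ Tendsto (fun n => (cnt A n : ℝ) / f n) atTop (nhds 0) := Iff.rfl
  rw [h, ← Asymptotics.isLittleO_iff_tendsto fun n hn => absurd hn (hf n).ne',
    Asymptotics.isLittleO_iff]
  simp

theorem ZgN_mono {f g : ℕ → ℕ} (hf : ∀ n, 0 < (f n : ℝ)) (hfg : ∀ n, f n ≤ g n) :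
    ZgN f ⊆ ZgN g := by
  intro A hA
  have hg : ∀ n, 0 < (g n : ℝ) := fun n => (hf n).trans_le (by exact_mod_cast hfg n)
  rw [mem_ZgN_iff hf] at hA
  rw [mem_ZgN_iff hg]
  intro ε hε
  filter_upwards [hA ε hε] with n hn
  have : (f n : ℝ) ≤ g n := by exact_mod_cast hfg n
  exact hn.trans (by gcongr)

theorem mem_ZgN_of_subset {f : ℕ → ℕ} (hf : ∀ n, 0 < (f n : ℝ)) {A B : Set ℕ} (h : A ⊆ B)
    (hB : B ∈ ZgN f) : A ∈ ZgN f := by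
  rw [mem_ZgN_iff hf] at hB ⊢
  intro ε hε
  filter_upwards [hB ε hε] with n hn
  exact le_trans (by exact_mod_cast cnt_mono_s5 h n) hn

theorem union_mem_ZgN {f : ℕ → ℕ} {A B : Set ℕ} (hf : ∀ n, 0 < (f n : ℝ))
    (hA : A ∈ ZgN f) (hB : B ∈ ZgN f) : A ∪ B ∈ ZgN f := by
  rw [mem_ZgN_iff hf] at *
  intro ε hε
  filter_upwards [hA (ε / 2) (half_pos hε), hB (ε / 2) (half_pos hε)] with n h₁ h₂
  have : (cnt (A ∪ B) n : ℝ) ≤ cnt A n + cnt B n := by exact_mod_cast cnt_union_le A B n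
  linarith

/-- The part of a set in `Z_{max{f,g}}` lying where `f` dominates `g` belongs to `Z_f`. -/
theorem sep_le_mem_ZgN {f g : ℕ → ℕ} (hf : inHup f) {A : Set ℕ}
    (hA : A ∈ ZgN fun n => max (f n) (g n)) :
    {x ∈ A | g (x + 1) ≤ f (x + 1)} ∈ ZgN f := by
  obtain ⟨⟨hpos, hlim, -⟩, hmono⟩ := hf
  have hmax : ∀ n, 0 < ((max (f n) (g n) : ℕ) : ℝ) := fun n =>
    (hpos n).trans_le (Nat.cast_le.2 (le_max_left _ _))
  rw [mem_ZgN_iff hmax] at hA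
  rw [mem_ZgN_iff hpos]
  intro ε hε
  obtain ⟨N, hN⟩ := eventually_atTop.1 (hA ε hε)
  set C := {x ∈ A | g (x + 1) ≤ f (x + 1)} with hC
  have key : ∀ n, (cnt C n : ℝ) ≤ max (N : ℝ) (ε * f n) := by
    intro n
    induction n with
    | zero => exact le_max_of_le_left (by exact_mod_cast (cnt_le C 0).trans N.zero_le)
    | succ n ih =>
      by_cases hn : g (n + 1) ≤ f (n + 1)
      · rcases le_total N (n + 1) with h | h
        · have h' := hN _ h
          rw [max_eq_left hn] at h'
          exact le_max_of_le_right
            (le_trans (by exact_mod_cast cnt_mono_s5 (Set.sep_subset _ _) _) h')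
        · exact le_max_of_le_left (by exact_mod_cast (cnt_le C _).trans h)
      · rw [cnt_succ_of_notMem fun h => hn h.2]
        have : (f n : ℝ) ≤ f (n + 1) := by exact_mod_cast hmono n.le_succ
        exact ih.trans (by gcongr)
  filter_upwards [hlim.eventually_ge_atTop (N / ε)] with n hn
  rw [div_le_iff₀' hε] at hn
  exact (key n).trans (max_le hn le_rfl)

/-- If `Z_f = Z_g` for nondecreasing `f, g ∈ G` with values in `ω`, then
`Z_{max{f,g}} = Z_f`. -/
theorem Zg_max_eq (f g : ℕ → ℕ) (hf : inHup f) (hg : inHup g)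
    (h : ZgN f = ZgN g) :
    ZgN (fun n => max (f n) (g n)) = ZgN f := by
  refine Set.Subset.antisymm (fun A hA => ?_) (ZgN_mono hf.1.1 fun n => le_max_left _ _)
  have h₁ := sep_le_mem_ZgN hf hA
  have h₂ : {x ∈ A | f (x + 1) ≤ g (x + 1)} ∈ ZgN f := by
    rw [h]
    exact sep_le_mem_ZgN hg (by simpa only [max_comm] using hA)
  refine mem_ZgN_of_subset hf.1.1 (fun x hx => ?_) (union_mem_ZgN hf.1.1 h₁ h₂)
  exact (le_total (g (x + 1)) (f (x + 1))).imp (⟨hx, ·⟩) (⟨hx, ·⟩)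
end

section
/- Let f ∈ H↑. If the quotient set S_f has more than one element, then S_f has cardinality 𝔠 (the cardinality of the continuum). -/
open Filter

open scoped ENNReal

/-- The relation `R`: `g R h` iff `limsup g(n)/h(n) < ∞` and `limsup h(n)/g(n) < ∞`. -/
def Rrel (g h : ℕ → ℕ) : Prop :=
  limsup (fun n => (g n : ℝ≥0∞) / (h n : ℝ≥0∞)) atTop < ⊤ ∧
  limsup (fun n => (h n : ℝ≥0∞) / (g n : ℝ≥0∞)) atTop < ⊤

/-- `S_f` : the quotient of `{g ∈ H↑ : Z_f = Z_g}` by the relation `R`. -/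
def Sf (f : ℕ → ℕ) : Type :=
  Quot (fun g h : {g : ℕ → ℕ // inHup g ∧ ZgN g = ZgN f} => Rrel g.1 h.1)

theorem limsup_div_lt_top_iff {g h : ℕ → ℕ} (hh : ∀ n, 0 < h n) :
    limsup (fun n => (g n : ℝ≥0∞) / (h n : ℝ≥0∞)) atTop < ⊤ ↔
      ∃ C : ℕ, ∀ᶠ n in atTop, g n ≤ C * h n := by
  have key : ∀ C n : ℕ, (g n : ℝ≥0∞) / (h n : ℝ≥0∞) ≤ C ↔ g n ≤ C * h n := by
    intro C n
    rw [ENNReal.div_le_iff (by exact_mod_cast (hh n).ne') (ENNReal.natCast_ne_top _)]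
    exact_mod_cast Iff.rfl
  constructor
  · intro hl
    obtain ⟨C, hC⟩ := ENNReal.exists_nat_gt hl.ne
    refine ⟨C, ?_⟩
    filter_upwards [eventually_lt_of_limsup_lt hC] with n hn
    exact (key C n).1 hn.le
  · rintro ⟨C, hC⟩
    refine lt_of_le_of_lt (limsup_le_of_le (a := (C : ℝ≥0∞)) ?_ ?_) (ENNReal.natCast_lt_top C)
    · isBoundedDefault
    · filter_upwards [hC] with n hn
      exact (key C n).2 hn

theorem inHup.pos {f : ℕ → ℕ} (hf : inHup f) (n : ℕ) : 0 < f n := by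
  exact Nat.cast_pos.1 (hf.1.1 n)

theorem inHup.tendsto {f : ℕ → ℕ} (hf : inHup f) : Tendsto f atTop atTop :=
  tendsto_natCast_atTop_iff.1 hf.1.2.1

theorem inHup.rrel_iff {g h : ℕ → ℕ} (hg : inHup g) (hh : inHup h) :
    Rrel g h ↔ (∃ C : ℕ, ∀ᶠ n in atTop, g n ≤ C * h n) ∧
      ∃ C : ℕ, ∀ᶠ n in atTop, h n ≤ C * g n := by
  rw [Rrel, limsup_div_lt_top_iff hh.pos, limsup_div_lt_top_iff hg.pos]

theorem exists_eventually_le_mul_trans {a b c : ℕ → ℕ}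
    (hab : ∃ C : ℕ, ∀ᶠ n in atTop, a n ≤ C * b n)
    (hbc : ∃ C : ℕ, ∀ᶠ n in atTop, b n ≤ C * c n) :
    ∃ C : ℕ, ∀ᶠ n in atTop, a n ≤ C * c n := by
  obtain ⟨C, hC⟩ := hab
  obtain ⟨D, hD⟩ := hbc
  refine ⟨C * D, ?_⟩
  filter_upwards [hC, hD] with n h₁ h₂
  calc a n ≤ C * b n := h₁
    _ ≤ C * (D * c n) := by gcongr
    _ = C * D * c n := by ring

theorem rrel_equivalence (f : ℕ → ℕ) :
    Equivalence (fun g h : {g : ℕ → ℕ // inHup g ∧ ZgN g = ZgN f} => Rrel g.1 h.1) where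
  refl g := (g.2.1.rrel_iff g.2.1).2
    ⟨⟨1, .of_forall fun n => by simp⟩, ⟨1, .of_forall fun n => by simp⟩⟩
  symm h := ⟨h.2, h.1⟩
  trans {a b c} h₁ h₂ := by
    rw [a.2.1.rrel_iff b.2.1] at h₁
    rw [b.2.1.rrel_iff c.2.1] at h₂
    exact (a.2.1.rrel_iff c.2.1).2 ⟨exists_eventually_le_mul_trans h₁.1 h₂.1,
      exists_eventually_le_mul_trans h₂.2 h₁.2⟩

theorem Sf_mk_eq_iff {f : ℕ → ℕ} (a b : {g : ℕ → ℕ // inHup g ∧ ZgN g = ZgN f}) :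
    (Quot.mk _ a : Sf f) = Quot.mk _ b ↔ Rrel a.1 b.1 :=
  (rrel_equivalence f).quot_mk_eq_iff a b

theorem ZgN_mono_s6 {g h : ℕ → ℕ} (hg : ∀ n, 0 < g n) (hgh : g ≤ h) : ZgN g ⊆ ZgN h := by
  intro A hA
  refine squeeze_zero (fun n => by positivity) (fun n => ?_) hA
  have h₁ : (0 : ℝ) < g n := by exact_mod_cast hg n
  have h₂ : (g n : ℝ) ≤ h n := by exact_mod_cast hgh n
  dsimp only
  gcongr

theorem inter_subset_ZgN_inf (g h : ℕ → ℕ) : ZgN g ∩ ZgN h ⊆ ZgN (g ⊓ h) := by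
  rintro A ⟨hg, hh⟩
  have hsum := Tendsto.add hg hh
  rw [add_zero] at hsum
  refine squeeze_zero (fun n => by positivity) (fun n => ?_) hsum
  rcases le_total (g n) (h n) with hle | hle
  · simp only [Pi.inf_apply, inf_eq_left.2 hle]
    exact le_add_of_nonneg_right (by positivity)
  · simp only [Pi.inf_apply, inf_eq_right.2 hle]
    exact le_add_of_nonneg_left (by positivity)

theorem inHup.of_le_of_le {f g h : ℕ → ℕ} (hf : inHup f) (hgpos : ∀ n, 0 < g n)
    (hg : Tendsto g atTop atTop) (hgh : g ≤ h) (hhf : h ≤ f) (hh : Monotone h) : inHup h := by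
  have hpos : ∀ n, 0 < h n := fun n => (hgpos n).trans_le (hgh n)
  refine ⟨⟨fun n => Nat.cast_pos.2 (hpos n),
    tendsto_natCast_atTop_iff.2 (tendsto_atTop_mono hgh hg), fun ht => hf.1.2.2 ?_⟩, hh⟩
  refine squeeze_zero (fun n => by positivity) (fun n => ?_) ht
  have h₁ : (0 : ℝ) < h n := by exact_mod_cast hpos n
  have h₂ : (h n : ℝ) ≤ f n := by exact_mod_cast hhf n
  gcongr

theorem inHup.inf {f g : ℕ → ℕ} (hf : inHup f) (hg : inHup g) : inHup (f ⊓ g) :=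
  hf.of_le_of_le (fun n => lt_min (hf.pos n) (hg.pos n))
    (tendsto_atTop.2 fun b => by
      filter_upwards [hf.tendsto.eventually_ge_atTop b, hg.tendsto.eventually_ge_atTop b]
        with n h₁ h₂ using le_min h₁ h₂)
    le_rfl inf_le_left (hf.2.inf hg.2)

theorem ZgN_inf {f g : ℕ → ℕ} (hf : inHup f) (hg : inHup g) (hfg : ZgN f = ZgN g) :
    ZgN (f ⊓ g) = ZgN f :=
  (ZgN_mono_s6 (hf.inf hg).pos inf_le_left).antisymm
    fun _ hA => inter_subset_ZgN_inf f g ⟨hA, hfg ▸ hA⟩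

/-- A sparse sequence along which `f / g` is unbounded. -/
theorem exists_sparse_seq {f g : ℕ → ℕ} (hg : Tendsto g atTop atTop)
    (hfg : ¬ ∃ C : ℕ, ∀ᶠ n in atTop, f n ≤ C * g n) :
    ∃ u : ℕ → ℕ, StrictMono u ∧ (∀ k, k * g (u k) < f (u k)) ∧
      ∀ k, f (u k) ≤ g (u (k + 1)) := by
  have hlarge : ∀ C N : ℕ, ∃ n ≥ N, C * g n < f n := by
    intro C N
    by_contra! hcon
    exact hfg ⟨C, eventually_atTop.2 ⟨N, hcon⟩⟩
  choose p hpN hp using hlarge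
  have hgrow : ∀ M : ℕ, ∃ N, ∀ n ≥ N, M ≤ g n := fun M =>
    eventually_atTop.1 (hg.eventually_ge_atTop M)
  choose q hq using hgrow
  let u : ℕ → ℕ := fun k => Nat.rec (p 0 0) (fun k m => p (k + 1) (max (m + 1) (q (f m)))) k
  have hsucc : ∀ k, max (u k + 1) (q (f (u k))) ≤ u (k + 1) := fun k => hpN _ _
  refine ⟨u, strictMono_nat_of_lt_succ fun k => (le_max_left _ _).trans (hsucc k), ?_,
    fun k => hq _ _ ((le_max_right _ _).trans (hsucc k))⟩
  rintro (_ | k)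
  · exact hp _ _
  · exact hp _ _

open Classical in
/-- The least nondecreasing function above `g` which agrees with `f` at `u k` for `k ∈ X`,
provided that `g ≤ f` and `f` is nondecreasing. -/
noncomputable def interpolate (f g u : ℕ → ℕ) (X : Set ℕ) (n : ℕ) : ℕ :=
  max (g n) (((Finset.range (n + 1)).filter fun k => k ∈ X ∧ u k ≤ n).sup fun k => f (u k))

section interpolate

variable {f g u : ℕ → ℕ} {X : Set ℕ}

theorem le_interpolate : g ≤ interpolate f g u X := fun _ => le_max_left _ _

theorem interpolate_le (hf : Monotone f) (hgf : g ≤ f) : interpolate f g u X ≤ f := by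
  classical
  intro n
  refine max_le (hgf n) (Finset.sup_le fun k hk => hf ?_)
  exact (Finset.mem_filter.1 hk).2.2

theorem interpolate_monotone (hg : Monotone g) : Monotone (interpolate f g u X) := by
  classical
  intro m n hmn
  refine max_le_max (hg hmn) (Finset.sup_mono fun k hk => ?_)
  simp only [Finset.mem_filter, Finset.mem_range] at hk ⊢
  exact ⟨by omega, hk.2.1, hk.2.2.trans hmn⟩

theorem le_interpolate_of_mem (hu : StrictMono u) {k : ℕ} (hk : k ∈ X) :
    f (u k) ≤ interpolate f g u X (u k) := by
  classical
  refine le_max_of_le_right (Finset.le_sup (f := fun k => f (u k)) ?_)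
  simp only [Finset.mem_filter, Finset.mem_range]
  exact ⟨Nat.lt_succ_of_le (hu.le_apply), hk, le_rfl⟩

theorem interpolate_of_notMem (hg : Monotone g) (hu : StrictMono u)
    (hfu : ∀ k, f (u k) ≤ g (u (k + 1))) {k : ℕ} (hk : k ∉ X) :
    interpolate f g u X (u k) = g (u k) := by
  classical
  refine max_eq_left (Finset.sup_le fun j hj => ?_)
  obtain ⟨-, hjX, hjk⟩ := Finset.mem_filter.1 hj
  have hlt : j < k := lt_of_le_of_ne (hu.le_iff_le.1 hjk) fun h => hk (h ▸ hjX)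
  exact (hfu j).trans (hg (hu.monotone hlt))

theorem not_interpolate_le_mul_interpolate {Y : Set ℕ} (hg : Monotone g) (hu : StrictMono u)
    (hlarge : ∀ k, k * g (u k) < f (u k)) (hfu : ∀ k, f (u k) ≤ g (u (k + 1)))
    (hXY : (X \ Y).Infinite) :
    ¬ ∃ C : ℕ, ∀ᶠ n in atTop, interpolate f g u X n ≤ C * interpolate f g u Y n := by
  rintro ⟨C, hC⟩
  obtain ⟨N, hN⟩ := eventually_atTop.1 hC
  obtain ⟨k, hk, hlt⟩ := hXY.exists_gt (max C N)
  have h₁ := hN (u k) ((le_max_right C N).trans (hlt.le.trans hu.le_apply))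
  rw [interpolate_of_notMem hg hu hfu hk.2] at h₁
  have h₂ : C * g (u k) ≤ k * g (u k) :=
    Nat.mul_le_mul_right _ ((le_max_left C N).trans hlt.le)
  exact absurd ((le_interpolate_of_mem hu hk.1).trans (h₁.trans h₂)) (hlarge k).not_ge

end interpolate

/-- The set of codes of pairs whose first coordinate is selected by `x`. -/
def columns (x : ℕ → Bool) : Set ℕ := {k | x k.unpair.1 = true}

theorem columns_diff_infinite {x y : ℕ → Bool} {i : ℕ} (hx : x i = true) (hy : y i = false) :
    (columns x \ columns y).Infinite := by
  refine Set.infinite_of_injective_forall_mem (f := fun j => Nat.pair i j) ?_ fun j => ?_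
  · intro j j' h
    exact (Nat.pair_eq_pair.1 h).2
  · simp [columns, hx, hy]

theorem mk_Sf_le_continuum (f : ℕ → ℕ) : Cardinal.mk (Sf f) ≤ Cardinal.continuum := by
  refine Cardinal.mk_quot_le.trans ((Cardinal.mk_subtype_le _).trans ?_)
  simp

theorem continuum_le_mk_Sf {f a g : ℕ → ℕ} (ha : inHup a) (haf : ZgN a = ZgN f)
    (hg : inHup g) (hgf : ZgN g = ZgN f) (hga : g ≤ a)
    (hbdd : ¬ ∃ C : ℕ, ∀ᶠ n in atTop, a n ≤ C * g n) :
    Cardinal.continuum ≤ Cardinal.mk (Sf f) := by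
  obtain ⟨u, hu, hlarge, hau⟩ := exists_sparse_seq hg.tendsto hbdd
  have hmem : ∀ X, inHup (interpolate a g u X) := fun X =>
    ha.of_le_of_le hg.pos hg.tendsto le_interpolate (interpolate_le ha.2 hga)
      (interpolate_monotone hg.2)
  have hZ : ∀ X, ZgN (interpolate a g u X) = ZgN f := fun X =>
    ((ZgN_mono_s6 (hmem X).pos (interpolate_le ha.2 hga)).trans haf.subset).antisymm
      (hgf.superset.trans (ZgN_mono_s6 hg.pos le_interpolate))
  let F : (ℕ → Bool) → Sf f := fun x =>
    Quot.mk _ ⟨interpolate a g u (columns x), hmem _, hZ _⟩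
  have hF : Function.Injective F := by
    intro x y hxy
    have hrel : Rrel (interpolate a g u (columns x)) (interpolate a g u (columns y)) :=
      (Sf_mk_eq_iff ⟨_, hmem _, hZ _⟩ ⟨_, hmem _, hZ _⟩).1 hxy
    have hR := ((hmem (columns x)).rrel_iff (hmem (columns y))).1 hrel
    funext i
    cases hx : x i <;> cases hy : y i
    · rfl
    · exact absurd hR.2 (not_interpolate_le_mul_interpolate hg.2 hu hlarge hau
        (columns_diff_infinite hy hx))
    · exact absurd hR.1 (not_interpolate_le_mul_interpolate hg.2 hu hlarge hau
        (columns_diff_infinite hx hy))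
    · rfl
  simpa using Cardinal.mk_le_of_injective hF

theorem continuum_le_mk_Sf_of_not_bounded {f a b : ℕ → ℕ} (ha : inHup a)
    (haf : ZgN a = ZgN f) (hb : inHup b) (hbf : ZgN b = ZgN f)
    (hbdd : ¬ ∃ C : ℕ, ∀ᶠ n in atTop, a n ≤ C * b n) :
    Cardinal.continuum ≤ Cardinal.mk (Sf f) := by
  refine continuum_le_mk_Sf ha haf (ha.inf hb)
    ((ZgN_inf ha hb (haf.trans hbf.symm)).trans haf) inf_le_left ?_
  rintro ⟨C, hC⟩
  refine hbdd ⟨C, hC.mono fun n hn => hn.trans ?_⟩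
  exact Nat.mul_le_mul_left C (min_le_right (a n) (b n))

/-- If `S_f` has more than one element, then it has cardinality `𝔠`. -/
theorem card_Sf_eq_continuum_of_nontrivial (f : ℕ → ℕ) (hf : inHup f)
    (h : ∃ x y : Sf f, x ≠ y) :
    Cardinal.mk (Sf f) = Cardinal.continuum := by
  refine (mk_Sf_le_continuum f).antisymm ?_
  obtain ⟨x, y, hxy⟩ := h
  obtain ⟨a, rfl⟩ := Quot.exists_rep x
  obtain ⟨b, rfl⟩ := Quot.exists_rep y
  have hR : ¬ Rrel a.1 b.1 := fun hR => hxy (Quot.sound hR)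
  rw [a.2.1.rrel_iff b.2.1, not_and_or] at hR
  rcases hR with hR | hR
  · exact continuum_le_mk_Sf_of_not_bounded a.2.1 a.2.2 b.2.1 b.2.2 hR
  · exact continuum_le_mk_Sf_of_not_bounded b.2.1 b.2.2 a.2.1 a.2.2 hR
end

section
/- Let A ⊆ G be a family whose cardinality is smaller than the bounding number 𝔟 (equivalently: every family of functions in ω^ω of cardinality |A| is bounded with respect to eventual domination ≤*). Then there exists a family G_0 ⊆ H↑ of cardinality 𝔠 such that: (1) for any two distinct f_1, f_2 ∈ G_0, neither Z_{f_1} ⊆ Z_{f_2} nor Z_{f_2} ⊆ Z_{f_1}; and (2) for any f ∈ A and any f_1 ∈ G_0, neither Z_f ⊆ Z_{f_1} nor Z_{f_1} ⊆ Z_f. -/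
open Filter

lemma mem_Zg_of_forall_mul_cnt_le {g : ℕ → ℝ} {S : Set ℕ} (hg : ∀ n, 0 < g n)
    (h : ∀ K : ℕ, ∀ᶠ n in atTop, (K : ℝ) * cnt S n ≤ g n) : S ∈ Zg g := by
  refine Metric.tendsto_atTop.2 fun ε hε => ?_
  obtain ⟨K, hK⟩ := exists_nat_gt (1 / ε)
  obtain ⟨N, hN⟩ := eventually_atTop.1 (h K)
  refine ⟨N, fun n hn => ?_⟩
  have h1 := hN n hn
  have hK0 : (0 : ℝ) < K := lt_trans (by positivity) hK
  have hle : (cnt S n : ℝ) / g n ≤ 1 / K := by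
    rw [div_le_div_iff₀ (hg n) hK0]
    linarith
  rw [Real.dist_eq, sub_zero, abs_of_nonneg (div_nonneg (Nat.cast_nonneg _) (hg n).le)]
  exact hle.trans_lt ((one_div_lt hε hK0).1 hK)

lemma not_tendsto_div_zero_of_frequently_le {a g : ℕ → ℝ} {C : ℝ} (hg : ∀ n, 0 < g n)
    (h : ∃ᶠ n in atTop, g n ≤ C * a n) : ¬ Tendsto (fun n => a n / g n) atTop (nhds 0) := by
  intro ht
  have h2 : Tendsto (fun n => C * (a n / g n)) atTop (nhds 0) := by
    simpa using ht.const_mul C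
  obtain ⟨n, hn, hn'⟩ := (h.and_eventually (h2.eventually_lt_const one_pos)).exists
  rw [← mul_div_assoc, div_lt_one (hg n)] at hn'
  linarith

lemma cnt_le_of_forall_lt {S : Set ℕ} {n b : ℕ} (h : ∀ m ∈ S, m < n → m < b) :
    cnt S n ≤ b := by
  have := Set.ncard_le_ncard (s := S ∩ Set.Iio n) (t := Set.Iio b) (fun m hm => h m hm.1 hm.2)
    (Set.finite_Iio b)
  simpa [cnt, Set.ncard_eq_toFinset_card'] using this

lemma le_cnt_of_Ico_subset {S : Set ℕ} {a n : ℕ} (h : Set.Ico a n ⊆ S) : n - a ≤ cnt S n := by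
  have := Set.ncard_le_ncard (s := Set.Ico a n) (t := S ∩ Set.Iio n)
    (fun m hm => ⟨h hm, hm.2⟩) ((Set.finite_Iio n).inter_of_right _)
  simpa [cnt, Set.ncard_eq_toFinset_card'] using this

lemma cnt_le_add {S : Set ℕ} {n a b c : ℕ}
    (h : ∀ m ∈ S, m < n → m < a ∨ (b ≤ m ∧ m < b + c)) : cnt S n ≤ a + c := by
  have h1 := Set.ncard_le_ncard (s := S ∩ Set.Iio n) (t := Set.Iio a ∪ Set.Ico b (b + c))
    (fun m hm => h m hm.1 hm.2) ((Set.finite_Iio a).union (Set.finite_Ico b _))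
  have h2 := Set.ncard_union_le (Set.Iio a) (Set.Ico b (b + c))
  simp only [Set.ncard_eq_toFinset_card' (Set.Iio a),
    Set.ncard_eq_toFinset_card' (Set.Ico b (b + c)), Set.toFinset_Iio, Set.toFinset_Ico,
    Nat.card_Iio, Nat.card_Ico] at h2
  unfold cnt
  omega

/-- The members of `inG` are linearly bounded along a subsequence. -/
lemma inG.exists_frequently_le {g : ℕ → ℝ} (hg : inG g) :
    ∃ C : ℝ, 0 < C ∧ ∃ᶠ n : ℕ in atTop, g n ≤ C * n := by
  by_contra! hcon
  refine hg.2.2 (Metric.tendsto_atTop.2 fun ε hε => ?_)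
  have h := hcon (1 / ε) (by positivity)
  obtain ⟨N, hN⟩ := eventually_atTop.1 h
  refine ⟨N, fun n hn => ?_⟩
  have h1 := hN n hn
  rw [Real.dist_eq, sub_zero, abs_of_nonneg (div_nonneg (Nat.cast_nonneg _) (hg.1 n).le),
    div_lt_iff₀ (hg.1 n)]
  rw [one_div, inv_mul_lt_iff₀ hε] at h1
  exact h1

section Blocks

variable (h : ℕ → ℕ)

/-- Left end points of a sequence of blocks growing faster than `h`. -/
def blockStart : ℕ → ℕ
  | 0 => 0
  | j + 1 =>
    h ((j + 1) * (h (blockStart j) + 2 * blockStart j + 1)) +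
      2 * ((j + 1) * (h (blockStart j) + 2 * blockStart j + 1))

/-- The point of the `j`-th block up to which the block is filled. -/
def blockMid (j : ℕ) : ℕ := h (blockStart h j) + 2 * blockStart h j + 1

/-- The value taken on the `j`-th block. -/
def blockVal (j : ℕ) : ℕ := (j + 1) * blockMid h j

/-- The point from which on the end of the `j`-th block is filled. -/
def blockTail (j : ℕ) : ℕ := h (blockVal h j) + blockVal h j

lemma blockStart_succ (j : ℕ) : blockStart h (j + 1) = blockTail h j + blockVal h j := by
  simp only [blockStart, blockTail, blockVal, blockMid]
  ring

lemma blockMid_le_blockVal (j : ℕ) : blockMid h j ≤ blockVal h j :=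
  Nat.le_mul_of_pos_left _ j.succ_pos

lemma lt_blockVal (j : ℕ) : j < blockVal h j :=
  Nat.le_mul_of_pos_right _ (Nat.succ_pos _)

lemma two_mul_blockStart_lt_blockMid (j : ℕ) : 2 * blockStart h j < blockMid h j := by
  unfold blockMid
  omega

lemma blockVal_le_blockTail (j : ℕ) : blockVal h j ≤ blockTail h j := Nat.le_add_left _ _

lemma blockVal_lt_blockStart_succ (j : ℕ) : blockVal h j < blockStart h (j + 1) := by
  have := blockStart_succ h j
  have := lt_blockVal h j
  have := blockVal_le_blockTail h j
  omega

lemma blockStart_strictMono : StrictMono (blockStart h) := strictMono_nat_of_lt_succ fun j => by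
  have := two_mul_blockStart_lt_blockMid h j
  have := blockMid_le_blockVal h j
  have := blockVal_lt_blockStart_succ h j
  omega

lemma blockMid_mono : Monotone (blockMid h) := monotone_nat_of_le_succ fun j => by
  have := two_mul_blockStart_lt_blockMid h (j + 1)
  have := blockMid_le_blockVal h j
  have := blockVal_lt_blockStart_succ h j
  omega

lemma blockVal_mono : Monotone (blockVal h) := fun _ _ hij =>
  Nat.mul_le_mul (Nat.succ_le_succ hij) (blockMid_mono h hij)

variable (X : Set ℕ)

open scoped Classical in
/-- The step function with value `blockVal h j + 1` from the `j`-th block on, for `j ∈ X`. -/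
noncomputable def stepFun (n : ℕ) : ℕ :=
  ((Finset.range n).filter fun j => j ∈ X ∧ blockStart h j < n).sup (blockVal h) + 1

/-- The initial parts of the blocks indexed by `X`. -/
def headSet : Set ℕ := {m | ∃ j ∈ X, blockStart h j ≤ m ∧ m < blockMid h j}

/-- The final parts of all the blocks. -/
def tailSet : Set ℕ := {m | ∃ j, blockTail h j ≤ m ∧ m < blockTail h j + blockVal h j}

variable {h X}

lemma blockVal_lt_stepFun {j n : ℕ} (hj : j ∈ X) (hn : blockStart h j < n) :
    blockVal h j < stepFun h X n := by
  classical
  have hjn : j < n := ((blockStart_strictMono h).le_apply).trans_lt hn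
  exact Nat.lt_succ_of_le (Finset.le_sup (f := blockVal h) (by simp [hj, hn, hjn]))

lemma stepFun_le {n b : ℕ} (hb : ∀ i ∈ X, blockStart h i < n → blockVal h i ≤ b) :
    stepFun h X n ≤ b + 1 := by
  classical
  refine Nat.succ_le_succ (Finset.sup_le fun i hi => ?_)
  simp only [Finset.mem_filter] at hi
  exact hb i hi.2.1 hi.2.2

lemma stepFun_mono : Monotone (stepFun h X) := by
  intro m n hmn
  refine stepFun_le fun i hi him => ?_
  exact Nat.le_of_lt_succ (blockVal_lt_stepFun hi (him.trans_le hmn))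

lemma stepFun_pos (n : ℕ) : (0 : ℝ) < (stepFun h X n : ℝ) := by
  exact_mod_cast Nat.succ_pos _

lemma stepFun_blockStart_succ_le (j : ℕ) :
    stepFun h X (blockStart h (j + 1)) ≤ blockVal h j + 1 :=
  stepFun_le fun _ _ hi =>
    blockVal_mono h (Nat.le_of_lt_succ ((blockStart_strictMono h).lt_iff_lt.1 hi))

lemma tendsto_stepFun (hX : X.Infinite) :
    Tendsto (fun n => (stepFun h X n : ℝ)) atTop atTop := by
  refine tendsto_natCast_atTop_atTop.comp (tendsto_atTop_atTop.2 fun b => ?_)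
  obtain ⟨j, hj, hbj⟩ := hX.exists_gt b
  refine ⟨blockStart h j + 1, fun n hn => ?_⟩
  have := blockVal_lt_stepFun (h := h) hj (n := n) hn
  have := lt_blockVal h j
  omega

lemma inHup_stepFun (hX : X.Infinite) : inHup (stepFun h X) := by
  refine ⟨⟨stepFun_pos, tendsto_stepFun hX,
    not_tendsto_div_zero_of_frequently_le (C := 1) stepFun_pos ?_⟩, stepFun_mono⟩
  refine frequently_atTop.2 fun N => ⟨blockStart h (N + 1), ?_, ?_⟩
  · exact (Nat.le_succ N).trans (blockStart_strictMono h).le_apply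
  · have h1 := stepFun_blockStart_succ_le (h := h) (X := X) N
    have h2 := blockVal_lt_blockStart_succ h N
    rw [one_mul]
    exact_mod_cast h1.trans h2

lemma headSet_mem_ZgN (hX : X.Infinite) : headSet h X ∈ ZgN (stepFun h X) := by
  classical
  refine mem_Zg_of_forall_mul_cnt_le stepFun_pos fun K => ?_
  obtain ⟨i, hi, hKi⟩ := hX.exists_gt K
  filter_upwards [eventually_gt_atTop (blockStart h i)] with n hn
  have hlt : ∀ j, blockStart h j < n → j < n := fun j hj =>
    ((blockStart_strictMono h).le_apply).trans_lt hj
  obtain ⟨j, hj, hmax⟩ := Finset.exists_max_image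
    ((Finset.range n).filter fun j => j ∈ X ∧ blockStart h j < n) id
    ⟨i, by simp [hi, hn, hlt i hn]⟩
  simp only [Finset.mem_filter, Finset.mem_range, id] at hj hmax
  have hij : i ≤ j := hmax i ⟨hlt i hn, hi, hn⟩
  have hcnt : cnt (headSet h X) n ≤ blockMid h j := cnt_le_of_forall_lt fun m hm hmn => by
    obtain ⟨k, hk, hkm, hmk⟩ := hm
    have hkn := hkm.trans_lt hmn
    exact hmk.trans_le (blockMid_mono h (hmax k ⟨hlt k hkn, hk, hkn⟩))
  have hval := blockVal_lt_stepFun (h := h) hj.2.1 hj.2.2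
  have : K * cnt (headSet h X) n ≤ blockVal h j :=
    Nat.mul_le_mul (by omega) hcnt
  exact_mod_cast this.trans hval.le

lemma headSet_notMem_Zg {g : ℕ → ℝ} {C : ℝ} (hC : 0 < C) (hg : ∀ n, 0 < g n)
    (hfreq : ∃ᶠ j in atTop, j ∈ X ∧
      ∃ n, 2 * blockStart h j ≤ n ∧ n ≤ blockMid h j ∧ g n ≤ C * n) :
    headSet h X ∉ Zg g := by
  refine not_tendsto_div_zero_of_frequently_le (C := 2 * C) hg (frequently_atTop.2 fun N => ?_)
  obtain ⟨j, hNj, hj, n, hjn, hnj, hgn⟩ := frequently_atTop.1 hfreq N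
  have hle := (blockStart_strictMono h).le_apply (x := j)
  refine ⟨n, by omega, hgn.trans ?_⟩
  have hcnt : n - blockStart h j ≤ cnt (headSet h X) n :=
    le_cnt_of_Ico_subset fun m hm => ⟨j, hj, hm.1, hm.2.trans_le hnj⟩
  have h2 : (n : ℝ) ≤ 2 * cnt (headSet h X) n := by
    have : n ≤ 2 * cnt (headSet h X) n := by omega
    exact_mod_cast this
  nlinarith

lemma headSet_notMem_ZgN_stepFun {Y : Set ℕ} (hXY : (X \ Y).Infinite) :
    headSet h X ∉ ZgN (stepFun h Y) := by
  refine headSet_notMem_Zg one_pos stepFun_pos ?_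
  refine (Nat.frequently_atTop_iff_infinite.2 hXY).mono fun j hj =>
    ⟨hj.1, blockMid h j, (two_mul_blockStart_lt_blockMid h j).le, le_rfl, ?_⟩
  have hstep : stepFun h Y (blockMid h j) ≤ blockStart h j + 1 := stepFun_le fun i hi hij => by
    have hlt := hij.trans_le ((blockMid_le_blockVal h j).trans (blockVal_lt_blockStart_succ h j).le)
    have hij' : i ≠ j := fun e => hj.2 (e ▸ hi)
    have : i < j := by
      have := (blockStart_strictMono h).lt_iff_lt.1 hlt
      omega
    exact (blockVal_lt_blockStart_succ h i).le.trans ((blockStart_strictMono h).monotone this)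
  have := two_mul_blockStart_lt_blockMid h j
  rw [one_mul]
  exact_mod_cast (show stepFun h Y (blockMid h j) ≤ blockMid h j by omega)

lemma tailSet_notMem_ZgN_stepFun : tailSet h ∉ ZgN (stepFun h X) := by
  refine not_tendsto_div_zero_of_frequently_le (C := 2) stepFun_pos
    (frequently_atTop.2 fun N => ⟨blockStart h (N + 1), ?_, ?_⟩)
  · exact (Nat.le_succ N).trans (blockStart_strictMono h).le_apply
  · have h1 := stepFun_blockStart_succ_le (h := h) (X := X) N
    have h2 : blockStart h (N + 1) - blockTail h N ≤ cnt (tailSet h) (blockStart h (N + 1)) :=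
      le_cnt_of_Ico_subset fun m hm => ⟨N, hm.1, by rw [← blockStart_succ]; exact hm.2⟩
    have h3 := blockStart_succ h N
    have h4 := lt_blockVal h N
    exact_mod_cast (show stepFun h X (blockStart h (N + 1)) ≤
      2 * cnt (tailSet h) (blockStart h (N + 1)) by omega)

lemma tailSet_mem_Zg {g : ℕ → ℝ} (hg : ∀ n, 0 < g n)
    (hgrow : ∀ᶠ m in atTop, ∀ n ≥ h m, (m : ℝ) ^ 2 ≤ g n) : tailSet h ∈ Zg g := by
  refine mem_Zg_of_forall_mul_cnt_le hg fun K => ?_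
  obtain ⟨N, hN⟩ := eventually_atTop.1 hgrow
  filter_upwards [eventually_ge_atTop (blockTail h (max N (2 * K)))] with n hn
  have hlt : ∀ j, blockTail h j ≤ n → j < n := fun j hj =>
    ((lt_blockVal h j).trans_le (blockVal_le_blockTail h j)).trans_le hj
  obtain ⟨j, hj, hmax⟩ := Finset.exists_max_image
    ((Finset.range n).filter fun j => blockTail h j ≤ n) id
    ⟨max N (2 * K), by simp only [Finset.mem_filter, Finset.mem_range]; exact ⟨hlt _ hn, hn⟩⟩
  simp only [Finset.mem_filter, Finset.mem_range, id] at hj hmax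
  have hij : max N (2 * K) ≤ j := hmax _ ⟨hlt _ hn, hn⟩
  have hjv := lt_blockVal h j
  have hcnt : cnt (tailSet h) n ≤ blockStart h j + blockVal h j :=
    cnt_le_add (b := blockTail h j) fun m hm hmn => by
      obtain ⟨k, hkm, hmk⟩ := hm
      have hkn := hkm.trans hmn.le
      rcases (hmax k ⟨hlt k hkn, hkn⟩).lt_or_eq with hkj | rfl
      · rw [← blockStart_succ] at hmk
        exact Or.inl (hmk.trans_le ((blockStart_strictMono h).monotone hkj))
      · exact Or.inr ⟨hkm, hmk⟩
  have h1 := two_mul_blockStart_lt_blockMid h j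
  have h2 := blockMid_le_blockVal h j
  have h3 := hN (blockVal h j) (by omega) n ((Nat.le_add_right _ _).trans hj.2)
  refine le_trans ?_ h3
  have : K * cnt (tailSet h) n ≤ blockVal h j ^ 2 := by
    calc K * cnt (tailSet h) n ≤ K * (2 * blockVal h j) := Nat.mul_le_mul_left _ (by omega)
      _ = (2 * K) * blockVal h j := by ring
      _ ≤ blockVal h j * blockVal h j := Nat.mul_le_mul_right _ (by omega)
      _ = blockVal h j ^ 2 := (sq _).symm
  exact_mod_cast this

end Blocks

/-- The code of the `n`-th initial segment of a binary sequence: its binary digits are `1`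
followed by the segment. -/
def branchCode (x : ℕ → Bool) : ℕ → ℕ
  | 0 => 1
  | n + 1 => 2 * branchCode x n + (x n).toNat

lemma branchCode_bounds (x : ℕ → Bool) (n : ℕ) :
    2 ^ n ≤ branchCode x n ∧ branchCode x n < 2 ^ (n + 1) := by
  induction n with
  | zero => simp [branchCode]
  | succ n ih =>
    have := (x n).toNat_le
    rw [pow_succ] at ih
    simp only [branchCode, pow_succ]
    omega

lemma branchCode_strictMono (x : ℕ → Bool) : StrictMono (branchCode x) :=
  strictMono_nat_of_lt_succ fun n =>
    (branchCode_bounds x n).2.trans_le (branchCode_bounds x (n + 1)).1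

lemma eq_of_branchCode_eq {x y : ℕ → Bool} {m n : ℕ} (hmn : branchCode x m = branchCode y n) :
    m = n := by
  have h1 := branchCode_bounds x m
  have h2 := branchCode_bounds y n
  have h3 := (Nat.pow_lt_pow_iff_right one_lt_two).1 (h1.1.trans_lt (hmn ▸ h2.2))
  have h4 := (Nat.pow_lt_pow_iff_right one_lt_two).1 (h2.1.trans_lt (hmn ▸ h1.2))
  omega

lemma branchCode_ne_of_lt {x y : ℕ → Bool} {k n : ℕ} (hk : x k ≠ y k) (hn : k < n) :
    branchCode x n ≠ branchCode y n := by
  induction n, hn using Nat.le_induction with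
  | base =>
    simp only [branchCode]
    cases hx : x k <;> cases hy : y k <;> simp_all <;> omega
  | succ n hn ih =>
    have := (x n).toNat_le
    have := (y n).toNat_le
    simp only [branchCode]
    omega

lemma infinite_range_branchCode (x : ℕ → Bool) : (Set.range (branchCode x)).Infinite :=
  Set.infinite_range_of_injective (branchCode_strictMono x).injective

lemma infinite_range_branchCode_diff {x y : ℕ → Bool} (hxy : x ≠ y) :
    (Set.range (branchCode x) \ Set.range (branchCode y)).Infinite := by
  obtain ⟨k, hk⟩ := Function.ne_iff.1 hxy
  refine ((Set.Ioi_infinite k).image (branchCode_strictMono x).injective.injOn).mono ?_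
  rintro _ ⟨n, hn, rfl⟩
  refine ⟨⟨n, rfl⟩, ?_⟩
  rintro ⟨m, hm⟩
  obtain rfl := eq_of_branchCode_eq hm
  exact branchCode_ne_of_lt hk hn hm.symm

/-- A function controlling, for a given member of `inG`, both its growth and the gaps between
the places where it is linearly bounded. -/
lemma inG.exists_gauge {g : ℕ → ℝ} (hg : inG g) :
    ∃ (C : ℝ) (b : ℕ → ℕ), 0 < C ∧ ∀ m,
      (∃ n, 2 * m ≤ n ∧ n ≤ b m ∧ g n ≤ C * n) ∧ ∀ n ≥ b m, (m : ℝ) ^ 2 ≤ g n := by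
  obtain ⟨C, hC, hfreq⟩ := hg.exists_frequently_le
  choose φ hφ hgφ using fun m : ℕ => frequently_atTop.1 hfreq (2 * m)
  choose ψ hψ using fun m : ℕ =>
    eventually_atTop.1 (hg.2.1.eventually_ge_atTop ((m : ℝ) ^ 2))
  exact ⟨C, fun m => max (φ m) (ψ m), hC, fun m =>
    ⟨⟨φ m, hφ m, le_max_left _ _, hgφ m⟩, fun n hn => hψ m n ((le_max_right _ _).trans hn)⟩⟩

/-- For any `A ⊆ G` of cardinality `< 𝔟` (expressed by: every family in `ω^ω` of
cardinality at most `|A|` is bounded w.r.t. eventual domination), there is a family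
`G_0 ⊆ H↑` of cardinality `𝔠` such that the ideals `Z_{f₁}`, `Z_{f₂}`, `Z_f` are
pairwise incomparable w.r.t. inclusion for distinct `f₁, f₂ ∈ G_0` and `f ∈ A`. -/
theorem antichain_inclusion_avoiding_small_family (A : Set (ℕ → ℝ))
    (hA : ∀ f ∈ A, inG f)
    (hsmall : ∀ B : Set (ℕ → ℕ), Cardinal.mk B ≤ Cardinal.mk A →
      ∃ h : ℕ → ℕ, ∀ b ∈ B, ∀ᶠ n in atTop, b n ≤ h n) :
    ∃ G0 : Set (ℕ → ℕ), (∀ g ∈ G0, inHup g) ∧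
      Cardinal.mk G0 = Cardinal.continuum ∧
      (∀ f1 ∈ G0, ∀ f2 ∈ G0, f1 ≠ f2 → ¬ ZgN f1 ⊆ ZgN f2 ∧ ¬ ZgN f2 ⊆ ZgN f1) ∧
      (∀ f ∈ A, ∀ f1 ∈ G0, ¬ Zg f ⊆ ZgN f1 ∧ ¬ ZgN f1 ⊆ Zg f) := by
  choose C b hC hb using fun f : A => (hA f f.2).exists_gauge
  obtain ⟨h, hh⟩ := hsmall (Set.range b) Cardinal.mk_range_le
  have hdom (f : A) : ∀ᶠ n in atTop, b f n ≤ h n := hh _ ⟨f, rfl⟩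
  let F : (ℕ → Bool) → ℕ → ℕ := fun x => stepFun h (Set.range (branchCode x))
  have hF {x y : ℕ → Bool} (hxy : x ≠ y) : ¬ ZgN (F x) ⊆ ZgN (F y) := fun hsub =>
    headSet_notMem_ZgN_stepFun (infinite_range_branchCode_diff hxy)
      (hsub (headSet_mem_ZgN (infinite_range_branchCode x)))
  have hinj : Function.Injective F := fun x y hxy => by
    by_contra hne
    exact hF hne (by rw [hxy])
  refine ⟨Set.range F, ?_, ?_, ?_, ?_⟩
  · rintro _ ⟨x, rfl⟩
    exact inHup_stepFun (infinite_range_branchCode x)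
  · rw [Cardinal.mk_range_eq F hinj]
    simp
  · rintro _ ⟨x, rfl⟩ _ ⟨y, rfl⟩ hne
    have hxy : x ≠ y := fun e => hne (by rw [e])
    exact ⟨hF hxy, hF hxy.symm⟩
  · rintro f hf _ ⟨x, rfl⟩
    have hX := infinite_range_branchCode x
    refine ⟨fun hsub => ?_, fun hsub => ?_⟩
    · refine tailSet_notMem_ZgN_stepFun (hsub (tailSet_mem_Zg (hA f hf).1 ?_))
      filter_upwards [hdom ⟨f, hf⟩] with m hm n hn
      exact (hb ⟨f, hf⟩ m).2 n (hm.trans hn)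
    · refine headSet_notMem_Zg (hC ⟨f, hf⟩) (hA f hf).1 ?_ (hsub (headSet_mem_ZgN hX))
      have hev := (blockStart_strictMono h).tendsto_atTop.eventually (hdom ⟨f, hf⟩)
      refine ((Nat.frequently_atTop_iff_infinite.2 hX).and_eventually hev).mono ?_
      rintro j ⟨hj, hbj⟩
      obtain ⟨n, hn1, hn2, hn3⟩ := (hb ⟨f, hf⟩ (blockStart h j)).1
      refine ⟨hj, n, hn1, hn2.trans (hbj.trans ?_), hn3⟩
      unfold blockMid
      omega
end

section
/- Every simple density ideal is below the classical density ideal in the Katětov order: for every g ∈ G, Z_g ≤_K Z; that is, there exists a function φ : ω → ω such that φ^{-1}[A] ∈ Z for every A ∈ Z_g. -/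
open Filter

/-- The Katětov order on ideals on `ω`. -/
def KatLE (I J : Set (Set ℕ)) : Prop := ∃ φ : ℕ → ℕ, ∀ A ∈ I, φ ⁻¹' A ∈ J

open Classical in
theorem cnt_eq_count (A : Set ℕ) (n : ℕ) : cnt A n = Nat.count (· ∈ A) n := by
  rw [cnt, Nat.count_eq_card_filter_range, ← Set.ncard_coe_finset]
  congr 1
  ext x
  simp [and_comm]

theorem cnt_add (A : Set ℕ) (m n : ℕ) :
    cnt A (m + n) = cnt A m + cnt ((m + ·) ⁻¹' A) n := by
  classical
  simp only [cnt_eq_count, Nat.count_add]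
  rfl

theorem cnt_congr {A B : Set ℕ} {n : ℕ} (h : ∀ i < n, i ∈ A ↔ i ∈ B) :
    cnt A n = cnt B n := by
  rw [cnt, cnt]
  congr 1
  ext i
  simp only [Set.mem_inter_iff, Set.mem_Iio]
  exact and_congr_left (h i)

theorem cnt_preimage_mod_mul (A : Set ℕ) (N q : ℕ) :
    cnt ((· % N) ⁻¹' A) (N * q) = q * cnt A N := by
  induction q with
  | zero => simp [cnt]
  | succ q ih =>
    have h : cnt ((N * q + ·) ⁻¹' ((· % N) ⁻¹' A)) N = cnt A N :=
      cnt_congr fun i hi => by simp [Nat.mod_eq_of_lt hi]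
    rw [Nat.mul_succ, cnt_add, ih, h, Nat.succ_mul]

/-- If `A` has density at most `δ` in `{0, …, N-1}`, then so has its `N`-periodic extension in
`{0, …, L-1}`, up to one extra period. -/
theorem cnt_preimage_mod_le {A : Set ℕ} {N : ℕ} {δ : ℝ}
    (hA : (cnt A N : ℝ) ≤ δ * N) (hδ : 0 ≤ δ) (hN : 0 < N) (L : ℕ) :
    (cnt ((· % N) ⁻¹' A) L : ℝ) ≤ δ * (L + N) := by
  have h₁ : cnt ((· % N) ⁻¹' A) L ≤ (L / N + 1) * cnt A N := by
    rw [← cnt_preimage_mod_mul]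
    exact cnt_mono _ (Nat.lt_mul_div_succ L hN).le
  have h₂ : (((L / N + 1) * N : ℕ) : ℝ) ≤ L + N := by
    rw [Nat.succ_mul]
    exact_mod_cast Nat.add_le_add_right (Nat.div_mul_le_self L N) N
  calc (cnt ((· % N) ⁻¹' A) L : ℝ) ≤ ((L / N + 1 : ℕ) : ℝ) * cnt A N := by exact_mod_cast h₁
    _ ≤ ((L / N + 1 : ℕ) : ℝ) * (δ * N) := by gcongr
    _ = δ * (((L / N + 1) * N : ℕ) : ℝ) := by push_cast; ring
    _ ≤ δ * (L + N) := by gcongr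

/-- Along a sequence that at least doubles, reduction modulo `N k` on each block
`[N k, N (k + 1))` pulls sets of density zero along `N` back to sets of density zero. -/
theorem preimage_mem_Zg_of_block_mod {N φ : ℕ → ℕ} (hpos : ∀ k, 0 < N k)
    (hdouble : ∀ k, 2 * N k ≤ N (k + 1))
    (hφ : ∀ k m, N k ≤ m → m < N (k + 1) → φ m = m % N k) {A : Set ℕ}
    (hA : ∀ δ > 0, ∀ᶠ k in atTop, (cnt A (N k) : ℝ) ≤ δ * N k) :
    φ ⁻¹' A ∈ Zg (fun n => (n : ℝ)) := by
  have hmono : StrictMono N := strictMono_nat_of_lt_succ fun k => by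
    have := hpos k
    have := hdouble k
    omega
  refine Metric.tendsto_atTop.2 fun ε hε => ?_
  obtain ⟨K, hK⟩ := eventually_atTop.1 (hA (ε / 4) (by positivity))
  set C : ℝ := (cnt (φ ⁻¹' A) (N K) : ℝ)
  have hblock : ∀ k ≥ K, ∀ n, N k ≤ n → n ≤ N (k + 1) →
      (cnt (φ ⁻¹' A) n : ℝ) ≤ cnt (φ ⁻¹' A) (N k) + ε / 4 * n := by
    intro k hk n hn hn'
    obtain ⟨L, rfl⟩ := Nat.exists_eq_add_of_le hn
    have h : cnt ((N k + ·) ⁻¹' (φ ⁻¹' A)) L = cnt ((· % N k) ⁻¹' A) L :=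
      cnt_congr fun i hi => by
        simp [hφ k (N k + i) (by omega) (by omega)]
    have := cnt_preimage_mod_le (hK k hk) (by positivity) (hpos k) L
    rw [cnt_add, h]
    push_cast
    linarith
  have hstart : ∀ k ≥ K, (cnt (φ ⁻¹' A) (N k) : ℝ) ≤ C + ε / 2 * N k := by
    intro k hk
    induction k, hk using Nat.le_induction with
    | base => simp only [C, le_add_iff_nonneg_right]; positivity
    | succ k hk ih =>
      have h₁ := hblock k hk _ (hmono.monotone k.le_succ) le_rfl
      have h₂ : (2 * N k : ℝ) ≤ N (k + 1) := by exact_mod_cast hdouble k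
      nlinarith
  obtain ⟨M, hM⟩ := exists_nat_gt (4 * C / ε)
  refine ⟨max (N K) M, fun n hn => ?_⟩
  have hnK : N K ≤ n := (le_max_left _ _).trans hn
  have hn0 : (0 : ℝ) < n := by exact_mod_cast (hpos K).trans_le hnK
  have hnM : (M : ℝ) ≤ n := by exact_mod_cast (le_max_right _ _).trans hn
  obtain ⟨k, hk, hkn, hnk⟩ : ∃ k ≥ K, N k ≤ n ∧ n < N (k + 1) := by
    have hle := Nat.findGreatest_spec (P := fun k => N k ≤ n) (hmono.le_apply.trans hnK) hnK
    refine ⟨_, Nat.le_findGreatest (hmono.le_apply.trans hnK) hnK, hle, ?_⟩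
    by_contra! h
    exact absurd (Nat.le_findGreatest (hmono.le_apply.trans h) h) (Nat.not_succ_le_self _)
  have h₁ := hblock k hk n hkn hnk.le
  have h₂ := hstart k hk
  have h₃ : (N k : ℝ) ≤ n := by exact_mod_cast hkn
  have h₄ : 4 * C < n * ε := (div_lt_iff₀ hε).1 (hM.trans_le hnM)
  rw [Real.dist_0_eq_abs, abs_of_nonneg (by positivity), div_lt_iff₀ hn0]
  nlinarith

theorem exists_doubling_seq {P : ℕ → Prop} (hP : ∀ m, ∃ n ≥ m, P n) :
    ∃ N : ℕ → ℕ, (∀ k, 0 < N k) ∧ (∀ k, 2 * N k ≤ N (k + 1)) ∧ ∀ k, P (N k) := by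
  choose s hs hPs using hP
  let N : ℕ → ℕ := Nat.rec (s 1) fun _ x => s (2 * x)
  have hdouble : ∀ k, 2 * N k ≤ N (k + 1) := fun k => hs _
  refine ⟨N, fun k => ?_, hdouble, fun k => ?_⟩
  · induction k with
    | zero => exact hs 1
    | succ k ih => have := hdouble k; omega
  · cases k <;> exact hPs _

theorem exists_block_mod {N : ℕ → ℕ} (hN : StrictMono N) :
    ∃ φ : ℕ → ℕ, ∀ k m, N k ≤ m → m < N (k + 1) → φ m = m % N k := by
  refine ⟨fun m => m % N (Nat.findGreatest (fun k => N k ≤ m) m), fun k m hk hm => ?_⟩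
  have : Nat.findGreatest (fun k => N k ≤ m) m = k := by
    refine Nat.findGreatest_eq_iff.2 ⟨hN.le_apply.trans hk, fun _ => hk, fun j hj _ h => ?_⟩
    exact (hm.trans_le (hN.monotone (Nat.succ_le_of_lt hj))).not_ge h
  simp only [this]

/-- Every simple density ideal is below the classical density ideal `Z`
in the Katětov order. -/
theorem Zg_katetov_le_Z (g : ℕ → ℝ) (hg : inG g) :
    KatLE (Zg g) (Zg (fun n => (n : ℝ))) := by
  obtain ⟨hgpos, -, hlim⟩ := hg
  obtain ⟨c, hc, hfreq⟩ : ∃ c > 0, ∀ m, ∃ n ≥ m, c * g n ≤ (n : ℝ) := by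
    rw [Metric.tendsto_atTop] at hlim
    push Not at hlim
    obtain ⟨c, hc, h⟩ := hlim
    refine ⟨c, hc, fun m => ?_⟩
    obtain ⟨n, hn, h⟩ := h m
    rw [Real.dist_0_eq_abs, abs_of_nonneg (div_nonneg n.cast_nonneg (hgpos n).le),
      le_div_iff₀ (hgpos n)] at h
    exact ⟨n, hn, h⟩
  obtain ⟨N, hpos, hdouble, hN⟩ := exists_doubling_seq hfreq
  have hmono : StrictMono N := strictMono_nat_of_lt_succ fun k => by
    have := hpos k
    have := hdouble k
    omega
  obtain ⟨φ, hφ⟩ := exists_block_mod hmono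
  refine ⟨φ, fun A hA => preimage_mem_Zg_of_block_mod hpos hdouble hφ fun δ hδ => ?_⟩
  have hA' : ∀ᶠ n in atTop, (cnt A n : ℝ) / g n < δ * c :=
    Tendsto.eventually_lt_const (by positivity) hA
  filter_upwards [hmono.tendsto_atTop.eventually hA'] with k hk
  rw [div_lt_iff₀ (hgpos _)] at hk
  have := mul_le_mul_of_nonneg_left (hN k) hδ.le
  linarith
end

section
/- Let (I_n)_{n∈ω} be a sequence of nonempty finite intervals in ω with max(I_n) < min(I_{n+1}) for all n, and let (a_n)_{n∈ω} be a nonincreasing sequence of positive reals. Define measures μ_n on subsets of ω by μ_n(A) = a_n · |A ∩ I_n|. Assume: a_n · min(I_n) → 0; a_n → 0; and a_n · |I_n| does not tend to 0. Define g : ω → (0,∞) by g(k) = 1/a_0 for k ≤ max(I_0) and g(k) = 1/a_{n+1} for max(I_n) < k ≤ max(I_{n+1}). Then g ∈ G and the density ideal generated by (μ_n), namely {A ⊆ ω : lim_{n→∞} sup_{m∈ω} μ_m(A ∖ {0,…,n−1}) = 0}, equals the simple density ideal Z_g. -/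
open Filter

open scoped ENNReal

/-- The density ideal of the measures `A ↦ a m * |A ∩ [lo m, hi m]|`, for consecutive intervals,
consists of the sets whose measures tend to `0`. -/
theorem tendsto_iSup_diff_Iio_iff (lo hi : ℕ → ℕ) (hle : ∀ n, lo n ≤ hi n)
    (hsep : ∀ n, hi n < lo (n + 1)) (a : ℕ → ℝ) (hpos : ∀ n, 0 < a n) (A : Set ℕ) :
    Tendsto (fun N => ⨆ m, ENNReal.ofReal (a m) *
        (((A \ Set.Iio N) ∩ Set.Icc (lo m) (hi m)).ncard : ℝ≥0∞)) atTop (nhds 0) ↔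
      Tendsto (fun m => a m * ((A ∩ Set.Icc (lo m) (hi m)).ncard : ℝ)) atTop (nhds 0) := by
  have hlo : StrictMono lo := strictMono_nat_of_lt_succ fun n => (hle n).trans_lt (hsep n)
  have hhi : StrictMono hi := strictMono_nat_of_lt_succ fun n => (hsep n).trans_le (hle _)
  have hreal : Tendsto (fun m => a m * ((A ∩ Set.Icc (lo m) (hi m)).ncard : ℝ)) atTop (nhds 0) ↔
      Tendsto (fun m => ENNReal.ofReal (a m) *
        ((A ∩ Set.Icc (lo m) (hi m)).ncard : ℝ≥0∞)) atTop (nhds 0) := by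
    rw [← ENNReal.tendsto_toReal_iff (fun m => by finiteness) (by simp)]
    simp [ENNReal.toReal_mul, ENNReal.toReal_ofReal (hpos _).le]
  rw [hreal, ENNReal.tendsto_nhds_zero, ENNReal.tendsto_nhds_zero]
  constructor
  · intro h ε hε
    obtain ⟨N, hN⟩ := (h ε hε).exists
    filter_upwards [eventually_ge_atTop N] with m hm
    have hset : (A \ Set.Iio N) ∩ Set.Icc (lo m) (hi m) = A ∩ Set.Icc (lo m) (hi m) := by
      ext x
      have := hlo.le_apply (x := m)
      simp only [Set.mem_inter_iff, Set.mem_sdiff, Set.mem_Iio, Set.mem_Icc]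
      constructor
      · tauto
      · rintro ⟨hx, h1, h2⟩
        exact ⟨⟨hx, by omega⟩, h1, h2⟩
    rw [← hset]
    exact (le_iSup (fun m => ENNReal.ofReal (a m) *
      (((A \ Set.Iio N) ∩ Set.Icc (lo m) (hi m)).ncard : ℝ≥0∞)) m).trans hN
  · intro h ε hε
    obtain ⟨M, hM⟩ := eventually_atTop.1 (h ε hε)
    filter_upwards [eventually_gt_atTop (hi M)] with N hN
    refine iSup_le fun m => ?_
    rcases le_total M m with hm | hm
    · refine le_trans ?_ (hM m hm)
      gcongr
      · exact (Set.finite_Icc _ _).inter_of_right _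
      · exact Set.sdiff_subset
    · have hset : (A \ Set.Iio N) ∩ Set.Icc (lo m) (hi m) = ∅ := by
        ext x
        have := hhi.monotone hm
        simp only [Set.mem_inter_iff, Set.mem_sdiff, Set.mem_Iio, Set.mem_Icc,
          Set.mem_empty_iff_false, iff_false]
        rintro ⟨⟨-, h1⟩, -, h2⟩
        omega
      simp [hset]

/-- The part of `A` below `k` lies below `l` or in `[l, u]` when `k ≤ u`. -/
theorem cnt_le_add_ncard_Icc (A : Set ℕ) {l u k : ℕ} (hk : k ≤ u) :
    cnt A k ≤ l + (A ∩ Set.Icc l u).ncard := by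
  have hsub : A ∩ Set.Iio k ⊆ Set.Iio l ∪ (A ∩ Set.Icc l u) := by
    intro x hx
    simp only [Set.mem_inter_iff, Set.mem_Iio, Set.mem_union, Set.mem_Icc] at hx ⊢
    by_cases h : x < l
    · exact Or.inl h
    · exact Or.inr ⟨hx.1, by omega, by omega⟩
  calc cnt A k ≤ (Set.Iio l ∪ (A ∩ Set.Icc l u)).ncard :=
        Set.ncard_le_ncard hsub ((Set.finite_Iio l).union ((Set.finite_Icc l u).inter_of_right A))
    _ ≤ (Set.Iio l).ncard + (A ∩ Set.Icc l u).ncard := Set.ncard_union_le _ _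
    _ = l + (A ∩ Set.Icc l u).ncard := by simp [Set.ncard_eq_toFinset_card']

theorem ncard_inter_Icc_le_cnt_add_one (A : Set ℕ) (l u : ℕ) :
    (A ∩ Set.Icc l u).ncard ≤ cnt A u + 1 := by
  have hsub : A ∩ Set.Icc l u ⊆ insert u (A ∩ Set.Iio u) := by
    intro x hx
    simp only [Set.mem_inter_iff, Set.mem_Iio, Set.mem_insert_iff, Set.mem_Icc] at hx ⊢
    by_cases h : x = u
    · exact Or.inl h
    · exact Or.inr ⟨hx.1, by omega⟩
  exact (Set.ncard_le_ncard hsub (((Set.finite_Iio u).inter_of_right A).insert u)).trans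
    (Set.ncard_insert_le _ _)

/-- A Farah density ideal generated by uniformly distributed measures on consecutive
intervals, with nonincreasing weights, is a simple density ideal. Here
`μ_n(A) = a_n · |A ∩ [lo n, hi n]|` and `g` is the associated function. -/
theorem farah_density_ideal_is_simple_density
    (lo hi : ℕ → ℕ) (hle : ∀ n, lo n ≤ hi n) (hsep : ∀ n, hi n < lo (n + 1))
    (a : ℕ → ℝ) (hpos : ∀ n, 0 < a n) (hanti : Antitone a)
    (h1 : Tendsto (fun n => a n * (lo n : ℝ)) atTop (nhds 0))
    (h2 : Tendsto a atTop (nhds 0))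
    (h3 : ¬ Tendsto (fun n => a n * ((hi n + 1 - lo n : ℕ) : ℝ)) atTop (nhds 0))
    (g : ℕ → ℝ)
    (hg0 : ∀ k ≤ hi 0, g k = 1 / a 0)
    (hgn : ∀ n k, hi n < k → k ≤ hi (n + 1) → g k = 1 / a (n + 1)) :
    inG g ∧
      {A : Set ℕ | Tendsto (fun N => ⨆ m, ENNReal.ofReal (a m) *
          (((A \ Set.Iio N) ∩ Set.Icc (lo m) (hi m)).ncard : ℝ≥0∞)) atTop (nhds 0)}
        = Zg g := by
  have hhi : StrictMono hi := strictMono_nat_of_lt_succ fun n => (hsep n).trans_le (hle _)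
  have hghi : ∀ n, g (hi n) = 1 / a n := by
    rintro (_ | n)
    · exact hg0 _ le_rfl
    · exact hgn n _ (hhi n.lt_succ_self) le_rfl
  have hblock : ∀ k, ∃ n, k ≤ hi n ∧ g k = 1 / a n := by
    intro k
    classical
    have hex : ∃ n, k ≤ hi n := ⟨k, hhi.le_apply⟩
    refine ⟨Nat.find hex, Nat.find_spec hex, ?_⟩
    rcases hn : Nat.find hex with _ | n
    · exact hg0 k (hn ▸ Nat.find_spec hex)
    · exact hgn n k (not_le.1 (Nat.find_min hex (by omega))) (hn ▸ Nat.find_spec hex)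
  choose ν hkν hgν using hblock
  have hν : Tendsto ν atTop atTop := by
    refine tendsto_atTop.2 fun b => ?_
    filter_upwards [eventually_gt_atTop (hi b)] with k hk
    exact (hhi.lt_iff_lt.1 (hk.trans_le (hkν k))).le
  have hhit : Tendsto hi atTop atTop := hhi.tendsto_atTop
  refine ⟨⟨fun k => ?_, ?_, fun h => h3 ?_⟩, ?_⟩
  · rw [hgν]
    exact one_div_pos.2 (hpos _)
  · have hinv : Tendsto (fun n => 1 / a n) atTop atTop := by
      simp only [one_div]
      exact Tendsto.inv_tendsto_nhdsGT_zero
        (tendsto_nhdsWithin_iff.2 ⟨h2, Eventually.of_forall hpos⟩)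
    exact (hinv.comp hν).congr fun k => (hgν k).symm
  · have hlim := (h.comp hhit).add h2
    rw [add_zero] at hlim
    refine squeeze_zero (fun n => mul_nonneg (hpos n).le (Nat.cast_nonneg _)) (fun n => ?_) hlim
    have hcard : ((hi n + 1 - lo n : ℕ) : ℝ) ≤ hi n + 1 := by
      exact_mod_cast Nat.sub_le _ _
    calc a n * ((hi n + 1 - lo n : ℕ) : ℝ) ≤ a n * (hi n + 1) :=
          mul_le_mul_of_nonneg_left hcard (hpos n).le
      _ = (hi n : ℝ) / g (hi n) + a n := by rw [hghi, one_div, div_inv_eq_mul]; ring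
  · ext A
    rw [Set.mem_ofPred_eq, tendsto_iSup_diff_Iio_iff lo hi hle hsep a hpos A, Zg, Set.mem_ofPred_eq]
    constructor
    · intro h
      have hlim := (h1.add h).comp hν
      rw [add_zero] at hlim
      refine squeeze_zero (fun k => ?_) (fun k => ?_) hlim
      · rw [hgν, one_div, div_inv_eq_mul]
        exact mul_nonneg (Nat.cast_nonneg _) (hpos _).le
      · have hcnt : (cnt A k : ℝ) ≤
            lo (ν k) + ((A ∩ Set.Icc (lo (ν k)) (hi (ν k))).ncard : ℝ) := by
          exact_mod_cast cnt_le_add_ncard_Icc A (hkν k)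
        rw [hgν, one_div, div_inv_eq_mul, mul_comm]
        exact (mul_le_mul_of_nonneg_left hcnt (hpos _).le).trans_eq (mul_add _ _ _)
    · intro h
      have hlim := (h.comp hhit).add h2
      rw [add_zero] at hlim
      refine squeeze_zero (fun n => mul_nonneg (hpos n).le (Nat.cast_nonneg _)) (fun n => ?_) hlim
      have hcard : ((A ∩ Set.Icc (lo n) (hi n)).ncard : ℝ) ≤ cnt A (hi n) + 1 := by
        exact_mod_cast ncard_inter_Icc_le_cnt_add_one A (lo n) (hi n)
      calc a n * ((A ∩ Set.Icc (lo n) (hi n)).ncard : ℝ) ≤ a n * (cnt A (hi n) + 1) :=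
            mul_le_mul_of_nonneg_left hcard (hpos n).le
        _ = (cnt A (hi n) : ℝ) / g (hi n) + a n := by rw [hghi, one_div, div_inv_eq_mul]; ring
end

section
/- Let I be an increasing-invariant ideal on ω containing all finite sets, and let A ⊆ ω be an infinite set with increasing enumeration A = {a_0 < a_1 < …}. If there exists a bijection φ : ω → A such that for every B ⊆ A one has B ∈ I ⇔ φ^{-1}[B] ∈ I (i.e., the restriction I|A is isomorphic to I), then the increasing enumeration itself is such an isomorphism: the map f : ω → A given by f(n) = a_n satisfies, for every B ⊆ A, B ∈ I ⇔ f^{-1}[B] ∈ I. -/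
open Filter

theorem cnt_image_le_cnt_image {X : Set ℕ} {f g : ℕ → ℕ} (hf : Set.InjOn f X)
    (hfg : ∀ x ∈ X, f x ≤ g x) (n : ℕ) : cnt (g '' X) n ≤ cnt (f '' X) n := by
  have hinj : Set.InjOn f (X ∩ f ⁻¹' Set.Iio n) := hf.mono Set.inter_subset_left
  have himg : f '' (X ∩ f ⁻¹' Set.Iio n) = f '' X ∩ Set.Iio n := Set.image_inter_preimage f X _
  have hfin : (X ∩ f ⁻¹' Set.Iio n).Finite := by
    refine Set.Finite.of_finite_image ?_ hinj
    rw [himg]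
    exact (Set.finite_Iio n).inter_of_right _
  calc (g '' X ∩ Set.Iio n).ncard
      ≤ (g '' (X ∩ f ⁻¹' Set.Iio n)).ncard := by
        refine Set.ncard_le_ncard ?_ (hfin.image g)
        rintro _ ⟨⟨x, hx, rfl⟩, hn⟩
        exact ⟨x, ⟨hx, (hfg x hx).trans_lt hn⟩, rfl⟩
    _ ≤ (X ∩ f ⁻¹' Set.Iio n).ncard := Set.ncard_image_le hfin
    _ = (f '' X ∩ Set.Iio n).ncard := by rw [← himg, hinj.ncard_image]

/-- The orbit of a point of `X` under an injection returns to `X` or exceeds its starting point. -/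
theorem exists_iterate_mem_or_lt {σ : ℕ → ℕ} (hσ : Function.Injective σ) {X : Set ℕ} {x : ℕ}
    (hx : x ∈ X) : ∃ k, σ^[k + 1] x ∈ X ∨ x < σ^[k + 1] x := by
  by_contra! h
  obtain ⟨i, -, j, -, hij, heq⟩ := Set.infinite_univ.exists_ne_map_eq_of_mapsTo
    (f := fun k => σ^[k + 1] x) (t := Set.Iic x) (fun k _ => (h k).2) (Set.finite_Iic x)
  have key : ∀ i j, i < j → σ^[i + 1] x = σ^[j + 1] x → False := by
    intro i j hlt heq
    obtain ⟨d, rfl⟩ := Nat.exists_eq_add_of_lt hlt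
    rw [show i + d + 1 + 1 = (i + 1) + (d + 1) by omega,
      Function.iterate_add_apply σ (i + 1) (d + 1)] at heq
    exact (h d).1 (hσ.iterate (i + 1) heq ▸ hx)
  rcases hij.lt_or_gt with hlt | hlt
  · exact key i j hlt heq
  · exact key j i hlt heq.symm

/-- Follow the orbit of each point of `X` until just before it first returns to `X` or exceeds its
starting point. This defines an injection `x ↦ σ^[k x] x` that does not increase any point. -/
theorem exists_injOn_iterate_le {σ : ℕ → ℕ} (hσ : Function.Injective σ) (X : Set ℕ) :
    ∃ k : ℕ → ℕ, Set.InjOn (fun x => σ^[k x] x) X ∧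
      ∀ x ∈ X, σ^[k x] x ≤ x ∧ (σ^[k x + 1] x ∈ X ∨ x < σ^[k x + 1] x) := by
  classical
  have hleast : ∀ x, ∃ k, x ∈ X → (σ^[k + 1] x ∈ X ∨ x < σ^[k + 1] x) ∧
      ∀ m < k, ¬ (σ^[m + 1] x ∈ X ∨ x < σ^[m + 1] x) := by
    intro x
    by_cases hx : x ∈ X
    · have hex := exists_iterate_mem_or_lt hσ hx
      exact ⟨Nat.find hex, fun _ => ⟨Nat.find_spec hex, fun m hm => Nat.find_min hex hm⟩⟩
    · exact ⟨0, fun h => absurd h hx⟩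
  choose k hk using hleast
  have hne : ∀ x ∈ X, ∀ y ∈ X, k x < k y → σ^[k x] x ≠ σ^[k y] y := by
    intro x hx y hy hlt heq
    obtain ⟨d, hd⟩ := Nat.exists_eq_add_of_lt hlt
    rw [show k y = k x + (d + 1) by omega, Function.iterate_add_apply σ (k x) (d + 1)] at heq
    exact (hk y hy).2 d (by omega) (Or.inl (hσ.iterate (k x) heq ▸ hx))
  refine ⟨k, fun x hx y hy heq => ?_, fun x hx => ⟨?_, (hk x hx).1⟩⟩
  · rcases lt_trichotomy (k x) (k y) with hlt | hxy | hlt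
    · exact absurd heq (hne x hx y hy hlt)
    · simp only [hxy] at heq
      exact hσ.iterate (k y) heq
    · exact absurd heq.symm (hne y hy x hx hlt)
  · rcases hkx : k x with _ | m
    · simp
    · exact not_lt.mp fun h => (hk x hx).2 m (by omega) (Or.inr h)

/-- For an increasing-invariant ideal `I` containing all finite sets: if some bijection
`φ : ω → A` witnesses that `I|A` is isomorphic to `I`, then the increasing enumeration
of `A` also witnesses it. -/
theorem increasing_enumeration_is_isomorphism (I : Set (Set ℕ))
    (hsub : ∀ B ∈ I, ∀ C : Set ℕ, C ⊆ B → C ∈ I)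
    (hunion : ∀ B ∈ I, ∀ C ∈ I, B ∪ C ∈ I)
    (huniv : Set.univ ∉ I)
    (hfin : ∀ B : Set ℕ, B.Finite → B ∈ I)
    (hinv : ∀ B ∈ I, ∀ C : Set ℕ, (∀ n, cnt C n ≤ cnt B n) → C ∈ I)
    (A : Set ℕ)
    (a : ℕ → ℕ) (ha : StrictMono a) (harange : Set.range a = A)
    (φ : ℕ → ℕ) (hφinj : Function.Injective φ) (hφrange : Set.range φ = A)
    (hiso : ∀ B : Set ℕ, B ⊆ A → (B ∈ I ↔ φ ⁻¹' B ∈ I)) :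
    ∀ B : Set ℕ, B ⊆ A → (B ∈ I ↔ a ⁻¹' B ∈ I) := by
  subst harange
  have hσ : ∀ n, ∃ m, a m = φ n := fun n => by
    have h : φ n ∈ Set.range φ := ⟨n, rfl⟩
    rwa [hφrange] at h
  choose σ hσ using hσ
  have hσinj : Function.Injective σ := fun m n h => hφinj (by rw [← hσ, ← hσ, h])
  intro B hB
  obtain ⟨X, rfl⟩ := Set.subset_range_iff_exists_image_eq.mp hB
  rw [Set.preimage_image_eq X ha.injective]
  constructor
  · intro hX
    obtain ⟨k, hkinj, hk⟩ := exists_injOn_iterate_le hσinj X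
    let X' : Set ℕ := {x ∈ X | x < σ^[k x + 1] x}
    let Y : Set ℕ := (fun x => σ^[k x + 1] x) '' X'
    have hX' : a '' X' ∈ I := hsub _ hX _ (Set.image_mono (Set.sep_subset _ _))
    have hY : a '' Y ∈ I := by
      refine hinv _ hX' _ fun n => ?_
      rw [Set.image_image]
      exact cnt_image_le_cnt_image ha.injective.injOn (fun x hx => ha.monotone hx.2.le) n
    have hXY : a '' (X ∪ Y) ∈ I := by
      rw [Set.image_union]
      exact hunion _ hX _ hY
    have hpre := (hiso _ (Set.image_subset_range _ _)).mp hXY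
    have hT : (fun x => σ^[k x] x) '' X ∈ I := by
      refine hsub _ hpre _ ?_
      rintro _ ⟨x, hx, rfl⟩
      refine ⟨σ^[k x + 1] x, ?_, by rw [Function.iterate_succ_apply', hσ]⟩
      rcases (hk x hx).2 with h | h
      · exact Or.inl h
      · exact Or.inr ⟨x, ⟨hx, h⟩, rfl⟩
    refine hinv _ hT _ fun n => ?_
    simpa using cnt_image_le_cnt_image (g := id) hkinj (fun x hx => (hk x hx).1) n
  · intro hX
    refine hinv _ hX _ fun n => ?_
    simpa using cnt_image_le_cnt_image (f := id) (Set.injOn_id X) (fun x _ => ha.le_apply) n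
end
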